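/- arXiv:1201.1171 — 2 statements merged into one kernel-verified Lean document; each statement's English description precedes it below -/
import Mathlib

section
/- (Lemma 2) Let d ≥ 2 and let X = (X_1,…,X_d) be a random vector on ℝ^d whose density f (with respect to Lebesgue measure) satisfies f(x) = ψ(‖x‖_∞) for some strictly decreasing function ψ : [0,∞) → [0,∞). Then for every x > 0, P(X_1 + X_2 ≥ 2x) < P(X_1 ≥ x). -/
open MeasureTheory ENNReal Set

/-- The l_∞ (sup) norm on ℝ^d. -/
noncomputable def supNorm {d : ℕ} (x : EuclideanSpace ℝ (Fin d)) : ℝ := ⨆ i, |x i|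

theorem supNorm_eq_norm {d : ℕ} (y : EuclideanSpace ℝ (Fin d)) :
    supNorm y = ‖WithLp.ofLp y‖ := by
  unfold supNorm
  apply le_antisymm
  · exact Real.iSup_le (fun i => norm_le_pi_norm (WithLp.ofLp y) i) (norm_nonneg _)
  · exact (pi_norm_le_iff_of_nonneg (Real.iSup_nonneg fun i => abs_nonneg _)).2
      fun i => le_ciSup (f := fun i => |y i|) (Set.finite_range _).bddAbove i

theorem supNorm_nonneg {d : ℕ} (y : EuclideanSpace ℝ (Fin d)) : 0 ≤ supNorm y := by
  rw [supNorm_eq_norm]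
  exact norm_nonneg _

theorem abs_le_supNorm {d : ℕ} (y : EuclideanSpace ℝ (Fin d)) (i : Fin d) :
    |y i| ≤ supNorm y := by
  rw [supNorm_eq_norm]
  exact norm_le_pi_norm (WithLp.ofLp y) i

theorem supNorm_le {d : ℕ} {y : EuclideanSpace ℝ (Fin d)} {r : ℝ} (hr : 0 ≤ r)
    (h : ∀ i, |y i| ≤ r) : supNorm y ≤ r :=
  Real.iSup_le h hr

theorem supNorm_lt {d : ℕ} {y : EuclideanSpace ℝ (Fin d)} {r : ℝ} (hr : 0 < r)
    (h : ∀ i, |y i| < r) : supNorm y < r := by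
  rw [supNorm_eq_norm]
  exact (pi_norm_lt_iff hr).2 h

theorem measurable_supNorm {d : ℕ} :
    Measurable (supNorm : EuclideanSpace ℝ (Fin d) → ℝ) := by
  have h : (supNorm : EuclideanSpace ℝ (Fin d) → ℝ) = fun y => ‖WithLp.ofLp y‖ :=
    funext supNorm_eq_norm
  rw [h]
  exact (by fun_prop : Continuous fun y : EuclideanSpace ℝ (Fin d) => ‖WithLp.ofLp y‖).measurable

theorem measurable_radial_density {d : ℕ} {ψ : ℝ → ℝ} (hψ : AntitoneOn ψ (Set.Ici 0)) :
    Measurable fun y : EuclideanSpace ℝ (Fin d) => ENNReal.ofReal (ψ (supNorm y)) := by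
  have hanti : Antitone fun t : ℝ => ψ (max t 0) := fun a b hab =>
    hψ (le_max_right a 0) (le_max_right b 0) (max_le_max_right 0 hab)
  have h := (hanti.measurable.comp (measurable_supNorm (d := d))).ennreal_ofReal
  simpa [Function.comp_def, max_eq_left (supNorm_nonneg _)] using h

/-- The map replacing `y i` by `2 * x - y i` in the coordinates `i` with `p i`; the other
coordinates are kept. -/
noncomputable def reflectCoords {d : ℕ} (p : Fin d → Prop) [DecidablePred p] (x : ℝ)
    (y : EuclideanSpace ℝ (Fin d)) : EuclideanSpace ℝ (Fin d) :=
  WithLp.toLp 2 fun i => if p i then 2 * x - y i else y i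

theorem measurePreserving_reflectCoords {d : ℕ} (p : Fin d → Prop) [DecidablePred p] (x : ℝ) :
    MeasurePreserving (reflectCoords p x) volume volume := by
  let S : EuclideanSpace ℝ (Fin d) ≃ₗᵢ[ℝ] EuclideanSpace ℝ (Fin d) :=
    LinearIsometryEquiv.piLpCongrRight 2 fun i =>
      if p i then LinearIsometryEquiv.neg ℝ else LinearIsometryEquiv.refl ℝ ℝ
  let c : EuclideanSpace ℝ (Fin d) := WithLp.toLp 2 fun i => if p i then 2 * x else 0
  have heq : reflectCoords p x = (fun y => y + c) ∘ S := by
    funext y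
    ext i
    by_cases hi : p i
    · simp [reflectCoords, S, c, hi, sub_eq_neg_add]
    · simp [reflectCoords, S, c, hi]
  rw [heq]
  exact (measurePreserving_add_right volume c).comp S.measurePreserving

theorem volume_coord_add_coord_eq {d : ℕ} (i j : Fin d) (hij : i ≠ j) (x : ℝ) :
    volume {y : EuclideanSpace ℝ (Fin d) | y i + y j = 2 * x} = 0 := by
  let φ : EuclideanSpace ℝ (Fin d) →ₗ[ℝ] ℝ :=
    (EuclideanSpace.proj i + EuclideanSpace.proj j : EuclideanSpace ℝ (Fin d) →L[ℝ] ℝ)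
  have hker : LinearMap.ker φ ≠ ⊤ := by
    intro h
    have hm : EuclideanSpace.single i (1 : ℝ) ∈ LinearMap.ker φ := h ▸ Submodule.mem_top
    simp [φ, hij.symm] at hm
  have h0 := Measure.addHaar_submodule (volume : Measure (EuclideanSpace ℝ (Fin d))) _ hker
  rw [← measure_preimage_add_right volume (WithLp.toLp 2 fun _ => -x)] at h0
  convert h0 using 2
  ext y
  simp only [Set.mem_ofPred_eq, Set.mem_preimage, SetLike.mem_coe, LinearMap.mem_ker]
  simp only [φ, ContinuousLinearMap.coe_coe, _root_.add_apply,
    PiLp.proj_apply, PiLp.add_apply]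
  constructor <;> intro h <;> linarith

/-- Lemma 2: if X has an l_∞-symmetric density f(x) = ψ(‖x‖_∞) with strictly decreasing ψ,
then for every x > 0, P(X₁ + X₂ ≥ 2x) < P(X₁ ≥ x). -/
theorem linfty_halfspace_prob_lt
    {d : ℕ} (hd : 2 ≤ d)
    (ψ : ℝ → ℝ) (hψ : StrictAntiOn ψ (Set.Ici 0)) (hψ0 : ∀ t ∈ Set.Ici (0 : ℝ), 0 ≤ ψ t)
    (F : Measure (EuclideanSpace ℝ (Fin d))) [IsProbabilityMeasure F]
    (hF : F = volume.withDensity fun x => ENNReal.ofReal (ψ (supNorm x))) :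
    ∀ x : ℝ, 0 < x →
      F {y | 2 * x ≤ y ⟨0, by omega⟩ + y ⟨1, by omega⟩} < F {y | x ≤ y ⟨0, by omega⟩} := by
  intro x hx
  set i₀ : Fin d := ⟨0, by omega⟩ with hi₀
  set i₁ : Fin d := ⟨1, by omega⟩ with hi₁
  have hne : i₀ ≠ i₁ := by simp [hi₀, hi₁]
  set g : EuclideanSpace ℝ (Fin d) → ℝ≥0∞ := fun y => ENNReal.ofReal (ψ (supNorm y)) with hg
  have hgm : Measurable g := measurable_radial_density hψ.antitoneOn
  let p : Fin d → Prop := fun i => i = i₀ ∨ i = i₁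
  set T := reflectCoords p x with hT
  have hTp : MeasurePreserving T volume volume := measurePreserving_reflectCoords p x
  have hT₀ (y) : T y i₀ = 2 * x - y i₀ := by simp [hT, reflectCoords, p]
  have hT₁ (y) : T y i₁ = 2 * x - y i₁ := by simp [hT, reflectCoords, p]
  have hT' (y) (i) (h₀ : i ≠ i₀) (h₁ : i ≠ i₁) : T y i = y i := by
    simp [hT, reflectCoords, p, h₀, h₁]
  set A : Set (EuclideanSpace ℝ (Fin d)) := {y | 2 * x ≤ y i₀ + y i₁} with hA
  set B : Set (EuclideanSpace ℝ (Fin d)) := {y | x ≤ y i₀} with hB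
  have hAm : MeasurableSet A := measurableSet_le (by fun_prop) (by fun_prop)
  have hBm : MeasurableSet B := measurableSet_le (by fun_prop) (by fun_prop)
  set C : Set (EuclideanSpace ℝ (Fin d)) := T ⁻¹' (B \ A) with hC
  have hCm : MeasurableSet C := hTp.measurable (hBm.diff hAm)
  have hmemC (y) : y ∈ C ↔ y i₀ ≤ x ∧ 2 * x < y i₀ + y i₁ := by
    simp only [hC, hA, hB, Set.mem_preimage, Set.mem_sdiff, Set.mem_ofPred_eq, hT₀, hT₁, not_le]
    constructor <;> rintro ⟨h₁, h₂⟩ <;> constructor <;> linarith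
  have hBA : F (B \ A) = ∫⁻ y in C, g (T y) := by
    rw [hF, withDensity_apply _ (hBm.diff hAm), hC,
      hTp.setLIntegral_comp_preimage (hBm.diff hAm) hgm]
  have hAB : F (A \ B) ≤ ∫⁻ y in C, g y := by
    rw [← withDensity_apply _ hCm, ← hF]
    have hac : F ≪ volume := hF ▸ withDensity_absolutelyContinuous _ _
    calc F (A \ B) ≤ F (C ∪ {y | y i₀ + y i₁ = 2 * x}) := by
          refine measure_mono fun y hy => ?_
          obtain ⟨h₁, h₂⟩ := hy
          simp only [hA, hB, Set.mem_ofPred_eq, not_le] at h₁ h₂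
          rcases h₁.lt_or_eq with h | h
          · exact Or.inl ((hmemC y).2 ⟨h₂.le, h⟩)
          · exact Or.inr h.symm
      _ ≤ F C + F {y | y i₀ + y i₁ = 2 * x} := measure_union_le _ _
      _ = F C := by rw [hac (volume_coord_add_coord_eq i₀ i₁ hne x), add_zero]
  have hle : ∀ y ∈ C, g y ≤ g (T y) := by
    intro y hy
    obtain ⟨h₀, h₁⟩ := (hmemC y).1 hy
    refine ENNReal.ofReal_le_ofReal
      (hψ.antitoneOn (supNorm_nonneg _) (supNorm_nonneg _) ?_)
    have hy₁ : y i₁ ≤ supNorm y := (le_abs_self _).trans (abs_le_supNorm y i₁)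
    refine supNorm_le (supNorm_nonneg _) fun i => ?_
    by_cases hi : i = i₀
    · rw [hi, hT₀, abs_le]
      constructor <;> linarith
    by_cases hi' : i = i₁
    · rw [hi', hT₁, abs_le]
      constructor <;> linarith
    rw [hT' y i hi hi']
    exact abs_le_supNorm y i
  set U : Set (EuclideanSpace ℝ (Fin d)) :=
    {y | y i₀ < x ∧ 2 * x < y i₀ + y i₁ ∧ ∀ i, i ≠ i₁ → |y i| < y i₁} with hU
  have hUC : U ⊆ C := fun y hy => (hmemC y).2 ⟨hy.1.le, hy.2.1⟩
  have hUo : IsOpen U := by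
    have h₀ : IsOpen {y : EuclideanSpace ℝ (Fin d) | y i₀ < x} :=
      isOpen_lt (by fun_prop) (by fun_prop)
    have h₁ : IsOpen {y : EuclideanSpace ℝ (Fin d) | 2 * x < y i₀ + y i₁} :=
      isOpen_lt (by fun_prop) (by fun_prop)
    have h₂ : IsOpen {y : EuclideanSpace ℝ (Fin d) | ∀ i, i ≠ i₁ → |y i| < y i₁} := by
      simp only [Set.ofPred_forall]
      exact isOpen_iInter_of_finite fun i => isOpen_iInter_of_finite fun _ =>
        isOpen_lt (by fun_prop) (by fun_prop)
    exact h₀.inter (h₁.inter h₂)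
  have hUne : U.Nonempty := by
    refine ⟨EuclideanSpace.single i₁ (3 * x), ?_, ?_, fun i hi => ?_⟩
    · simpa [hne] using hx
    · simp [hne]
      linarith
    · simpa [hi] using hx
  have hlt : ∀ y ∈ U, g y < g (T y) := by
    rintro y ⟨h₀, h₁, h₂⟩
    have hy₁ : y i₁ ≤ supNorm y := (le_abs_self _).trans (abs_le_supNorm y i₁)
    have hs : supNorm (T y) < supNorm y := by
      refine supNorm_lt (by linarith) fun i => ?_
      by_cases hi : i = i₀
      · rw [hi, hT₀, abs_lt]
        constructor <;> linarith
      by_cases hi' : i = i₁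
      · rw [hi', hT₁, abs_lt]
        constructor <;> linarith
      rw [hT' y i hi hi']
      exact (h₂ i hi').trans_le hy₁
    have hψlt := hψ (supNorm_nonneg _) (supNorm_nonneg _) hs
    exact (ENNReal.ofReal_lt_ofReal_iff
      ((hψ0 _ (supNorm_nonneg _)).trans_lt hψlt)).2 hψlt
  have hstrict : ∫⁻ y in C, g y < ∫⁻ y in C, g (T y) := by
    refine lintegral_strict_mono_of_ae_le_of_ae_lt_on
      (s := U) (hgm.comp hTp.measurable).aemeasurable ?_ ?_ ?_ ?_
    · rw [← withDensity_apply _ hCm, ← hF]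
      exact measure_ne_top F C
    · exact (ae_restrict_iff' hCm).2 (.of_forall hle)
    · rw [Measure.restrict_apply hUo.measurableSet, Set.inter_eq_left.2 hUC]
      exact (hUo.measure_pos volume hUne).ne'
    · exact .of_forall hlt
  rw [← measure_inter_add_sdiff A hBm, ← measure_inter_add_sdiff B hAm, Set.inter_comm B A]
  exact ENNReal.add_lt_add_left (measure_ne_top F _) (hAB.trans_lt (hBA ▸ hstrict))
end

section
/- (Lemma 4) Let d ≥ 2, let 0 < p < ∞, and let X = (X_1,…,X_d) be a random vector on ℝ^d whose density f (with respect to Lebesgue measure) satisfies f(x) = ψ(‖x‖_p) for some non-increasing function ψ : [0,∞) → [0,∞). If X_1 and 2^{(1−p)/p}(X_1 + X_2) are identically distributed, then p = 2. -/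
open MeasureTheory ENNReal Set

/-- The l_p "norm" on ℝ^d for a real parameter p > 0. -/
noncomputable def lpNormR {d : ℕ} (p : ℝ) (x : EuclideanSpace ℝ (Fin d)) : ℝ :=
  (∑ i, |x i| ^ p) ^ (1 / p)

/-- The measure on `(0, ∞)` with density `r ↦ r ^ (n - 1) * φ r`. -/
noncomputable def radialMeasure (n : ℕ) (φ : ℝ → ℝ≥0∞) : Measure ℝ :=
  (volume.restrict (Ioi 0)).withDensity fun r => ENNReal.ofReal (r ^ n * r⁻¹) * φ r

instance (n : ℕ) (φ : ℝ → ℝ≥0∞) : SFinite (radialMeasure n φ) := by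
  unfold radialMeasure; infer_instance

lemma ae_pos_radialMeasure (n : ℕ) (φ : ℝ → ℝ≥0∞) : ∀ᵐ r ∂radialMeasure n φ, 0 < r :=
  (withDensity_absolutelyContinuous _ _).ae_le (ae_restrict_mem measurableSet_Ioi)

/-- Invariance of `dr / r` on `(0, ∞)` under `r ↦ a / r`. -/
lemma lintegral_Ioi_inv_mul_comp_div {a : ℝ} (ha : 0 < a) (f : ℝ → ℝ≥0∞) :
    ∫⁻ r in Ioi 0, ENNReal.ofReal r⁻¹ * f (a / r) = ∫⁻ r in Ioi 0, ENNReal.ofReal r⁻¹ * f r := by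
  have himg : (fun r => a / r) '' Ioi 0 = Ioi 0 := by
    ext y
    constructor
    · rintro ⟨r, hr, rfl⟩
      exact div_pos ha hr
    · intro hy
      exact ⟨a / y, div_pos ha hy, div_div_cancel₀ ha.ne'⟩
  have hinj : InjOn (fun r => a / r) (Ioi 0) := by
    intro x _ y _ hxy
    simpa [div_eq_mul_inv, ha.ne'] using hxy
  have hderiv : ∀ x ∈ Ioi (0 : ℝ),
      HasDerivWithinAt (fun r => a / r) (-(a / x ^ 2)) (Ioi 0) x := by
    intro x hx
    have := ((hasDerivAt_inv (ne_of_gt hx)).const_mul a).hasDerivWithinAt (s := Ioi 0)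
    refine this.congr_deriv ?_ |>.congr (fun y _ => div_eq_mul_inv _ _) (div_eq_mul_inv _ _)
    ring
  have key := lintegral_image_eq_lintegral_abs_deriv_mul measurableSet_Ioi hderiv hinj
    (fun r => ENNReal.ofReal r⁻¹ * f r)
  rw [himg] at key
  rw [key]
  refine setLIntegral_congr_fun measurableSet_Ioi fun r (hr : 0 < r) => ?_
  rw [← mul_assoc, ← ENNReal.ofReal_mul (abs_nonneg _), abs_neg, abs_of_pos (by positivity)]
  congr 2
  field_simp

section Gauge

variable {E : Type*} [NormedAddCommGroup E] [NormedSpace ℝ E] [MeasurableSpace E] [BorelSpace E]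
  [FiniteDimensional ℝ E] (μ : Measure E) [μ.IsAddHaarMeasure]

lemma lintegral_comp_smul_of_pos {r : ℝ} (hr : 0 < r) (g : E → ℝ≥0∞) (hg : Measurable g) :
    ENNReal.ofReal (r ^ Module.finrank ℝ E) * ∫⁻ x, g (r • x) ∂μ = ∫⁻ x, g x ∂μ := by
  rw [← lintegral_map (f := g) hg (measurable_const_smul r), Measure.map_addHaar_smul μ hr.ne',
    lintegral_smul_measure, smul_eq_mul, ← mul_assoc, ← ENNReal.ofReal_mul (by positivity),
    abs_of_pos (by positivity), mul_inv_cancel₀ (by positivity), ENNReal.ofReal_one, one_mul]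

variable {μ} {N : E → ℝ}

lemma lintegral_smul_gauge_prod_radial (hN : Measurable N)
    (hsmul : ∀ r : ℝ, 0 < r → ∀ x, N (r • x) = r * N x)
    {φ ψ : ℝ → ℝ≥0∞} (hφ : Measurable φ) (hψ : Measurable ψ) {k : E → ℝ≥0∞} (hk : Measurable k) :
    ∫⁻ z, k (z.2 • z.1)
        ∂((μ.withDensity fun x => ψ (N x)).prod (radialMeasure (Module.finrank ℝ E) φ)) =
      ∫⁻ y, k y * (∫⁻ r in Ioi 0, ENNReal.ofReal r⁻¹ * (ψ (N y / r) * φ r)) ∂μ := by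
  have hdens : Measurable fun x => ψ (N x) := hψ.comp hN
  rw [lintegral_prod_symm' _ (by fun_prop), radialMeasure,
    lintegral_withDensity_eq_lintegral_mul _ (by fun_prop)]
  · have inner : ∀ r ∈ Ioi (0 : ℝ),
        ((fun r => ENNReal.ofReal (r ^ Module.finrank ℝ E * r⁻¹) * φ r) *
          (fun r => ∫⁻ x, k (r • x) ∂(μ.withDensity fun x => ψ (N x))) : ℝ → ℝ≥0∞) r =
        ∫⁻ y, k y * (ENNReal.ofReal r⁻¹ * (ψ (N y / r) * φ r)) ∂μ := by
      intro r (hr : 0 < r)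
      have hg : Measurable fun y => k y * (ENNReal.ofReal r⁻¹ * (ψ (N y / r) * φ r)) := by
        fun_prop
      rw [← lintegral_comp_smul_of_pos μ hr _ hg, Pi.mul_apply,
        lintegral_withDensity_eq_lintegral_mul _ hdens (by fun_prop),
        ENNReal.ofReal_mul (by positivity), mul_assoc, mul_assoc, ← mul_assoc (ENNReal.ofReal r⁻¹),
        ← lintegral_const_mul _ (by fun_prop)]
      congr 1
      refine lintegral_congr fun x => ?_
      rw [hsmul r hr, mul_div_cancel_left₀ _ hr.ne', Pi.mul_apply]
      ring
    rw [setLIntegral_congr_fun measurableSet_Ioi inner, lintegral_lintegral_swap]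
    · refine lintegral_congr fun y => ?_
      rw [lintegral_const_mul _ (by fun_prop)]
    · exact Measurable.aemeasurable (by fun_prop)
  · exact Measurable.lintegral_prod_left' (f := fun z : E × ℝ => k (z.2 • z.1)) (by fun_prop)

/-- A vector with density `ψ ∘ N`, multiplied by an independent radius with density
`r ^ (n - 1) * φ r`, has a law which is symmetric in `φ` and `ψ`. -/
lemma map_smul_gauge_prod_radial_comm (hN : Measurable N)
    (hsmul : ∀ r : ℝ, 0 < r → ∀ x, N (r • x) = r * N x) (hpos : ∀ᵐ x ∂μ, 0 < N x)
    {φ ψ : ℝ → ℝ≥0∞} (hφ : Measurable φ) (hψ : Measurable ψ) :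
    ((μ.withDensity fun x => ψ (N x)).prod (radialMeasure (Module.finrank ℝ E) φ)).map
        (fun z => z.2 • z.1) =
      ((μ.withDensity fun x => φ (N x)).prod (radialMeasure (Module.finrank ℝ E) ψ)).map
        (fun z => z.2 • z.1) := by
  refine Measure.ext_of_lintegral _ fun k hk => ?_
  rw [lintegral_map hk (by fun_prop), lintegral_map hk (by fun_prop),
    lintegral_smul_gauge_prod_radial hN hsmul hφ hψ hk,
    lintegral_smul_gauge_prod_radial hN hsmul hψ hφ hk]
  refine lintegral_congr_ae ?_
  filter_upwards [hpos] with y hy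
  rw [← lintegral_Ioi_inv_mul_comp_div hy]
  congr 1
  refine setLIntegral_congr_fun measurableSet_Ioi fun r (hr : 0 < r) => ?_
  rw [div_div_cancel₀ hy.ne', mul_comm (ψ r)]

end Gauge

lemma integral_cpow_mul_integral_cpow_comm {E : Type*} [NormedAddCommGroup E] [NormedSpace ℝ E]
    [MeasurableSpace E] [BorelSpace E] [FiniteDimensional ℝ E] {μ : Measure E}
    [μ.IsAddHaarMeasure] {N : E → ℝ} (hN : Measurable N)
    (hsmul : ∀ r : ℝ, 0 < r → ∀ x, N (r • x) = r * N x) (hpos : ∀ᵐ x ∂μ, 0 < N x)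
    {φ ψ : ℝ → ℝ≥0∞} (hφ : Measurable φ) (hψ : Measurable ψ) (ℓ : E →L[ℝ] ℝ) (s : ℂ) :
    (∫ x, ((|ℓ x| : ℝ) : ℂ) ^ s ∂μ.withDensity fun x => ψ (N x)) *
        ∫ r, ((|r| : ℝ) : ℂ) ^ s ∂radialMeasure (Module.finrank ℝ E) φ =
      (∫ x, ((|ℓ x| : ℝ) : ℂ) ^ s ∂μ.withDensity fun x => φ (N x)) *
        ∫ r, ((|r| : ℝ) : ℂ) ^ s ∂radialMeasure (Module.finrank ℝ E) ψ := by
  have hmeas : Measurable fun x : E => ((|ℓ x| : ℝ) : ℂ) ^ s :=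
    (Complex.measurable_ofReal.comp (by fun_prop : Measurable fun x => |ℓ x|)).pow_const s
  have split : ∀ z : E × ℝ,
      ((|ℓ z.1| : ℝ) : ℂ) ^ s * ((|z.2| : ℝ) : ℂ) ^ s = ((|ℓ (z.2 • z.1)| : ℝ) : ℂ) ^ s := by
    intro z
    rw [← Complex.mul_cpow_ofReal_nonneg (abs_nonneg _) (abs_nonneg _), map_smul, smul_eq_mul,
      abs_mul, Complex.ofReal_mul, mul_comm]
  have h := congrArg (fun m : Measure E => ∫ x, ((|ℓ x| : ℝ) : ℂ) ^ s ∂m)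
    (map_smul_gauge_prod_radial_comm hN hsmul hpos hφ hψ)
  rw [integral_map (by fun_prop) hmeas.aestronglyMeasurable,
    integral_map (by fun_prop) hmeas.aestronglyMeasurable] at h
  simp_rw [← split] at h
  rwa [integral_prod_mul (fun x => ((|ℓ x| : ℝ) : ℂ) ^ s) (fun r : ℝ => ((|r| : ℝ) : ℂ) ^ s),
    integral_prod_mul (fun x => ((|ℓ x| : ℝ) : ℂ) ^ s) (fun r : ℝ => ((|r| : ℝ) : ℂ) ^ s)] at h

lemma abs_cpow_eq_exp {t : ℝ} (ht : t ≠ 0) (s : ℂ) :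
    ((|t| : ℝ) : ℂ) ^ s = Complex.exp (s * (Real.log |t| : ℝ)) := by
  rw [Complex.cpow_def_of_ne_zero (by simpa using ht), Complex.ofReal_log (abs_nonneg t), mul_comm]

lemma eventually_integral_cpow_ne_zero {ν : Measure ℝ} [IsFiniteMeasure ν] (hν : ν ≠ 0)
    (hpos : ∀ᵐ r ∂ν, 0 < r) :
    ∀ᶠ t : ℝ in nhds 0, ∫ r, ((|r| : ℝ) : ℂ) ^ (t * Complex.I) ∂ν ≠ 0 := by
  have h : ∀ t : ℝ, ∫ r, ((|r| : ℝ) : ℂ) ^ (t * Complex.I) ∂ν =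
      charFun (ν.map fun r => Real.log |r|) t := by
    intro t
    rw [charFun_apply_real, integral_map (by fun_prop) (by fun_prop)]
    refine integral_congr_ae ?_
    filter_upwards [hpos] with r hr
    rw [abs_cpow_eq_exp hr.ne']
    ring_nf
  simp_rw [h]
  refine continuous_charFun.continuousAt.eventually_ne ?_
  rw [charFun_zero, ne_eq, Complex.ofReal_eq_zero, measureReal_eq_zero_iff,
    Measure.measure_univ_eq_zero, Measure.map_eq_zero_iff (by fun_prop)]
  exact hν

section Mellin

open ProbabilityTheory

variable {Ω : Type*} [MeasurableSpace Ω] {G : Measure Ω}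

lemma Ioo_subset_integrableExpSet_log_abs {U : Ω → ℝ} (h0 : ∀ᵐ ω ∂G, U ω ≠ 0) {a b : ℝ}
    (ha : Integrable (fun ω => |U ω| ^ a) G) (hb : Integrable (fun ω => |U ω| ^ b) G) :
    Ioo a b ⊆ interior (integrableExpSet (fun ω => Real.log |U ω|) G) := by
  have key : ∀ c : ℝ, Integrable (fun ω => |U ω| ^ c) G →
      c ∈ integrableExpSet (fun ω => Real.log |U ω|) G := by
    intro c hc
    refine hc.congr ?_
    filter_upwards [h0] with ω hω
    rw [Real.rpow_def_of_pos (abs_pos.2 hω), mul_comm]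
  refine interior_maximal ?_ isOpen_Ioo
  exact Ioo_subset_Icc_self.trans (convex_integrableExpSet.ordConnected.out (key a ha) (key b hb))

lemma complexMGF_log_abs {U : Ω → ℝ} (h0 : ∀ᵐ ω ∂G, U ω ≠ 0) (s : ℂ) :
    complexMGF (fun ω => Real.log |U ω|) G s = ∫ ω, ((|U ω| : ℝ) : ℂ) ^ s ∂G := by
  refine integral_congr_ae ?_
  filter_upwards [h0] with ω hω
  rw [abs_cpow_eq_exp hω]

/-- If the Mellin transforms of `|U|` and `|V|` agree on the imaginary axis near `0`, then `U` and
`V` have the same second moment, as long as these transforms are analytic on a strip that contains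
`0` and `2`. -/
lemma integral_sq_eq_of_eventually_integral_cpow_eq {U V : Ω → ℝ} (hU0 : ∀ᵐ ω ∂G, U ω ≠ 0)
    (hV0 : ∀ᵐ ω ∂G, V ω ≠ 0) {a b : ℝ} (ha : a < 0) (hb : 2 < b)
    (hUa : Integrable (fun ω => |U ω| ^ a) G) (hUb : Integrable (fun ω => |U ω| ^ b) G)
    (hVa : Integrable (fun ω => |V ω| ^ a) G) (hVb : Integrable (fun ω => |V ω| ^ b) G)
    (h : ∀ᶠ t : ℝ in nhds 0, ∫ ω, ((|U ω| : ℝ) : ℂ) ^ (t * Complex.I) ∂G =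
      ∫ ω, ((|V ω| : ℝ) : ℂ) ^ (t * Complex.I) ∂G) :
    ∫ ω, U ω ^ 2 ∂G = ∫ ω, V ω ^ 2 ∂G := by
  have hpre : IsPreconnected (Complex.re ⁻¹' Ioo a b) :=
    ((convex_Ioo a b).linear_preimage Complex.reLm).isPreconnected
  have hfreq : ∃ᶠ z in nhdsWithin (0 : ℂ) {0}ᶜ, complexMGF (fun ω => Real.log |U ω|) G z =
      complexMGF (fun ω => Real.log |V ω|) G z := by
    have htend : Filter.Tendsto (fun t : ℝ => (t : ℂ) * Complex.I) (nhdsWithin 0 {0}ᶜ)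
        (nhdsWithin 0 {0}ᶜ) := by
      refine tendsto_nhdsWithin_of_tendsto_nhds_of_eventually_within _ ?_ ?_
      · refine Filter.Tendsto.mono_left ?_ nhdsWithin_le_nhds
        have : Continuous fun t : ℝ => (t : ℂ) * Complex.I := by fun_prop
        simpa using this.tendsto 0
      · filter_upwards [self_mem_nhdsWithin] with t ht
        simpa using ht
    refine htend.frequently (Filter.Eventually.frequently ?_)
    filter_upwards [nhdsWithin_le_nhds h] with t ht
    rw [complexMGF_log_abs hU0, complexMGF_log_abs hV0, ht]
  have heq := (analyticOnNhd_complexMGF.mono fun z hz =>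
      Ioo_subset_integrableExpSet_log_abs hU0 hUa hUb hz).eqOn_of_preconnected_of_frequently_eq
    (analyticOnNhd_complexMGF.mono fun z hz =>
      Ioo_subset_integrableExpSet_log_abs hV0 hVa hVb hz) hpre
    (show (0 : ℂ) ∈ Complex.re ⁻¹' Ioo a b from ⟨by simpa using ha, by simp; linarith⟩) hfreq
    (show (2 : ℂ) ∈ Complex.re ⁻¹' Ioo a b from ⟨by simp; linarith, by simpa using hb⟩)
  rw [complexMGF_log_abs hU0, complexMGF_log_abs hV0] at heq
  have hsq : ∀ W : Ω → ℝ, ∫ ω, ((|W ω| : ℝ) : ℂ) ^ (2 : ℂ) ∂G = (∫ ω, W ω ^ 2 ∂G : ℝ) := by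
    intro W
    rw [← integral_complex_ofReal]
    refine integral_congr_ae (.of_forall fun ω => ?_)
    have : ((|W ω| : ℝ) : ℂ) ^ (2 : ℂ) = ((|W ω| : ℝ) : ℂ) ^ 2 := by
      exact_mod_cast Complex.cpow_natCast ((|W ω| : ℝ) : ℂ) 2
    simp only [this]
    rw [← Complex.ofReal_pow, sq_abs]
  rw [hsq, hsq] at heq
  exact_mod_cast heq

end Mellin

section Integrability

variable {d : ℕ}

lemma integrableOn_ball_abs_apply_rpow (i : Fin d) {t : ℝ} (ht : -1 < t) (K : ℝ) :
    IntegrableOn (fun x : EuclideanSpace ℝ (Fin d) => |x i| ^ t) (Metric.ball 0 K) := by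
  rcases le_or_gt K 0 with hK | hK
  · rw [Metric.ball_eq_empty.2 hK]
    exact integrableOn_empty
  have h1 : IntegrableOn (fun u : ℝ => |u| ^ t) (Metric.ball 0 K) := by
    refine (integrableOn_fun_norm_addHaar (E := ℝ) volume (f := fun u => u ^ t)).2 ?_
    simpa using (intervalIntegral.integrableOn_Ioo_rpow_iff hK).2 ht
  have h2 : ∀ j : Fin d, Integrable ((Metric.ball (0 : ℝ) K).indicator
      fun u => if j = i then |u| ^ t else 1) := by
    intro j
    rw [integrable_indicator_iff measurableSet_ball]
    split_ifs
    · exact h1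
    · exact integrableOn_const measure_ball_lt_top.ne
  have h3 := (PiLp.volume_preserving_ofLp (Fin d)).integrable_comp_of_integrable
    (Integrable.fintype_prod h2)
  refine (h3.integrableOn (s := Metric.ball 0 K)).congr_fun (fun x hx => ?_) measurableSet_ball
  have hxj : ∀ j, x j ∈ Metric.ball (0 : ℝ) K := fun j => by
    rw [mem_ball_zero_iff] at hx ⊢
    exact (PiLp.norm_apply_le x j).trans_lt hx
  simp only [Function.comp, Set.indicator_of_mem (hxj _)]
  rw [Finset.prod_ite_eq' Finset.univ i]
  simp

lemma integrableOn_ball_abs_inner_rpow {w : EuclideanSpace ℝ (Fin d)} (hw : w ≠ 0) {t : ℝ}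
    (ht : -1 < t) (K : ℝ) :
    IntegrableOn (fun x => |inner ℝ w x| ^ t) (Metric.ball 0 K) := by
  obtain ⟨i, -⟩ : ∃ i, w i ≠ 0 := by
    by_contra! h
    exact hw (PiLp.ext h)
  let v : EuclideanSpace ℝ (Fin d) := ‖w‖ • EuclideanSpace.single i 1
  have hv : ‖v‖ = ‖w‖ := by simp [v, norm_smul]
  let ρ := (ℝ ∙ (v - w))ᗮ.reflection
  have hρ : ρ v = w := Submodule.reflection_sub hv
  have hpre : ρ ⁻¹' Metric.ball 0 K = Metric.ball 0 K := by
    ext x; simp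
  have h : IntegrableOn (fun x : EuclideanSpace ℝ (Fin d) => ‖w‖ ^ t * |x i| ^ t)
      (Metric.ball 0 K) := (integrableOn_ball_abs_apply_rpow i ht K).const_mul (‖w‖ ^ t)
  rw [← ρ.measurePreserving.integrableOn_comp_preimage ρ.toHomeomorph.measurableEmbedding,
    hpre] at h
  refine h.congr_fun (fun x _ => ?_) measurableSet_ball
  have : inner ℝ w x = ‖w‖ * ρ x i := calc
    inner ℝ w x = inner ℝ (ρ v) (ρ (ρ x)) := by rw [hρ, Submodule.reflection_reflection]
    _ = inner ℝ v (ρ x) := ρ.inner_map_map _ _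
    _ = ‖w‖ * ρ x i := by
      generalize ρ x = y
      simp [v, inner_smul_left, EuclideanSpace.inner_single_left]
  simp only [Function.comp, this]
  rw [abs_mul, Real.mul_rpow (abs_nonneg _) (abs_nonneg _), abs_norm]

lemma ae_inner_ne_zero {w : EuclideanSpace ℝ (Fin d)} (hw : w ≠ 0) :
    ∀ᵐ x : EuclideanSpace ℝ (Fin d), inner ℝ w x ≠ 0 := by
  have h := Measure.addHaar_submodule (volume : Measure (EuclideanSpace ℝ (Fin d)))
    (innerSL ℝ w).toLinearMap.ker (by
      intro htop
      have : w ∈ (innerSL ℝ w).toLinearMap.ker := by rw [htop]; trivial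
      exact hw (by simpa using this))
  rw [ae_iff]
  convert! h using 2
  ext x
  simp

end Integrability

section LpNorm

variable {d : ℕ} {p : ℝ}

lemma continuous_lpNormR (hp : 0 < p) :
    Continuous (lpNormR p : EuclideanSpace ℝ (Fin d) → ℝ) := by
  have h : 0 ≤ 1 / p := by positivity
  unfold lpNormR
  refine Continuous.rpow_const (continuous_finsetSum _ fun i _ => ?_) fun _ => Or.inr h
  exact Continuous.rpow_const (by fun_prop) fun _ => Or.inr hp.le

lemma lpNormR_nonneg (x : EuclideanSpace ℝ (Fin d)) : 0 ≤ lpNormR p x :=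
  Real.rpow_nonneg (Finset.sum_nonneg fun _ _ => Real.rpow_nonneg (abs_nonneg _) _) _

lemma lpNormR_smul_of_pos (hp : 0 < p) {r : ℝ} (hr : 0 < r) (x : EuclideanSpace ℝ (Fin d)) :
    lpNormR p (r • x) = r * lpNormR p x := by
  have h : ∑ i, |(r • x) i| ^ p = r ^ p * ∑ i, |x i| ^ p := by
    rw [Finset.mul_sum]
    refine Finset.sum_congr rfl fun i _ => ?_
    rw [PiLp.smul_apply, smul_eq_mul, abs_mul, abs_of_pos hr,
      Real.mul_rpow hr.le (abs_nonneg _)]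
  unfold lpNormR
  rw [h, Real.mul_rpow (by positivity)
    (Finset.sum_nonneg fun _ _ => Real.rpow_nonneg (abs_nonneg _) _), one_div,
    Real.rpow_rpow_inv hr.le hp.ne']

lemma abs_apply_le_lpNormR (hp : 0 < p) (x : EuclideanSpace ℝ (Fin d)) (i : Fin d) :
    |x i| ≤ lpNormR p x := by
  have h : |x i| ^ p ≤ ∑ j, |x j| ^ p :=
    Finset.single_le_sum (f := fun j => |x j| ^ p)
      (fun _ _ => Real.rpow_nonneg (abs_nonneg _) _) (Finset.mem_univ i)
  calc |x i| = (|x i| ^ p) ^ (1 / p) := by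
        rw [one_div, Real.rpow_rpow_inv (abs_nonneg _) hp.ne']
    _ ≤ lpNormR p x := Real.rpow_le_rpow (by positivity) h (by positivity)

lemma lpNormR_zero (hp : 0 < p) : lpNormR p (0 : EuclideanSpace ℝ (Fin d)) = 0 := by
  simp [lpNormR, Real.zero_rpow hp.ne', hp.ne']

lemma setOf_lpNormR_lt_one_subset (hp : 0 < p) :
    {x : EuclideanSpace ℝ (Fin d) | lpNormR p x < 1} ⊆ Metric.ball 0 (d + 1) := by
  intro x (hx : lpNormR p x < 1)
  rw [mem_ball_zero_iff]
  refine lt_of_pow_lt_pow_left₀ 2 (by positivity) ?_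
  rw [EuclideanSpace.norm_sq_eq]
  calc ∑ i, ‖x i‖ ^ 2 ≤ ∑ _i : Fin d, (1 : ℝ) := Finset.sum_le_sum fun i _ =>
        pow_le_one₀ (norm_nonneg _) ((abs_apply_le_lpNormR hp x i).trans hx.le)
    _ = d := by simp
    _ < (d + 1) ^ 2 := by nlinarith [(Nat.cast_nonneg d : (0 : ℝ) ≤ d)]

lemma measurableSet_lpNormR_lt_one (hp : 0 < p) :
    MeasurableSet {x : EuclideanSpace ℝ (Fin d) | lpNormR p x < 1} :=
  (isOpen_lt (continuous_lpNormR hp) continuous_const).measurableSet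

lemma setIntegral_lpNormR_lt_one_comp
    (e : EuclideanSpace ℝ (Fin d) ≃ₗᵢ[ℝ] EuclideanSpace ℝ (Fin d))
    (he : ∀ x, lpNormR p (e x) = lpNormR p x) (f : EuclideanSpace ℝ (Fin d) → ℝ) :
    ∫ x in {x | lpNormR p x < 1}, f (e x) = ∫ x in {x | lpNormR p x < 1}, f x := by
  have h := e.measurePreserving.setIntegral_preimage_emb e.toHomeomorph.measurableEmbedding f
    {x | lpNormR p x < 1}
  simpa [he] using h

lemma integrableOn_inner_sq (hp : 0 < p) (w : EuclideanSpace ℝ (Fin d)) :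
    IntegrableOn (fun x => inner ℝ w x ^ 2) {x | lpNormR p x < 1} := by
  have hc : Continuous fun x => inner ℝ w x ^ 2 := by fun_prop
  exact (hc.continuousOn.integrableOn_compact (isCompact_closedBall 0 ((d : ℝ) + 1))).mono_set
    ((setOf_lpNormR_lt_one_subset hp).trans Metric.ball_subset_closedBall)

/-- On the `l_p` unit ball, distinct coordinates are uncorrelated and have equal second moments. -/
lemma setIntegral_add_sq_eq (hp : 0 < p) {i j : Fin d} (hij : i ≠ j) :
    ∫ x : EuclideanSpace ℝ (Fin d) in {x | lpNormR p x < 1}, (x i + x j) ^ 2 =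
      2 * ∫ x : EuclideanSpace ℝ (Fin d) in {x | lpNormR p x < 1}, x i ^ 2 := by
  have hi : IntegrableOn (fun x : EuclideanSpace ℝ (Fin d) => x i ^ 2) {x | lpNormR p x < 1} := by
    simpa [EuclideanSpace.inner_single_left] using
      integrableOn_inner_sq hp (EuclideanSpace.single i (1 : ℝ))
  have hj : IntegrableOn (fun x : EuclideanSpace ℝ (Fin d) => x j ^ 2) {x | lpNormR p x < 1} := by
    simpa [EuclideanSpace.inner_single_left] using
      integrableOn_inner_sq hp (EuclideanSpace.single j (1 : ℝ))
  have ha : IntegrableOn (fun x : EuclideanSpace ℝ (Fin d) => (x i + x j) ^ 2)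
      {x | lpNormR p x < 1} := by
    simpa [EuclideanSpace.inner_single_left, inner_add_left] using
      integrableOn_inner_sq hp (EuclideanSpace.single i (1 : ℝ) + EuclideanSpace.single j (1 : ℝ))
  have hs : IntegrableOn (fun x : EuclideanSpace ℝ (Fin d) => (x i - x j) ^ 2)
      {x | lpNormR p x < 1} := by
    simpa [EuclideanSpace.inner_single_left, inner_sub_left] using
      integrableOn_inner_sq hp (EuclideanSpace.single i (1 : ℝ) - EuclideanSpace.single j (1 : ℝ))
  let e : EuclideanSpace ℝ (Fin d) ≃ₗᵢ[ℝ] EuclideanSpace ℝ (Fin d) :=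
    LinearIsometryEquiv.piLpCongrRight 2 fun k =>
      if k = j then LinearIsometryEquiv.neg ℝ else LinearIsometryEquiv.refl ℝ ℝ
  have he : ∀ x k, e x k = if k = j then -x k else x k := by
    intro x k
    simp only [e, LinearIsometryEquiv.piLpCongrRight_apply]
    split_ifs <;> simp
  let σ : EuclideanSpace ℝ (Fin d) ≃ₗᵢ[ℝ] EuclideanSpace ℝ (Fin d) :=
    LinearIsometryEquiv.piLpCongrLeft 2 ℝ ℝ (Equiv.swap i j)
  have hσ : ∀ x k, σ x k = x (Equiv.swap i j k) := by
    intro x k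
    simp [σ, LinearIsometryEquiv.piLpCongrLeft_apply, Equiv.piCongrLeft']
  have hflip := setIntegral_lpNormR_lt_one_comp (p := p) e (fun x => by
    unfold lpNormR
    congr 2 with k
    rw [he]
    split_ifs <;> simp) (fun x => (x i + x j) ^ 2)
  have hswap := setIntegral_lpNormR_lt_one_comp (p := p) σ (fun x => by
    unfold lpNormR
    simp only [hσ]
    rw [Equiv.sum_comp (Equiv.swap i j) fun k => |x k| ^ p]) (fun x => x i ^ 2)
  simp only [hσ, Equiv.swap_apply_left] at hswap
  simp only [he, if_neg hij, if_true, ← sub_eq_add_neg] at hflip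
  have hsum : ∫ x : EuclideanSpace ℝ (Fin d) in {x | lpNormR p x < 1},
      ((x i + x j) ^ 2 + (x i - x j) ^ 2) =
      ∫ x : EuclideanSpace ℝ (Fin d) in {x | lpNormR p x < 1}, (2 * x i ^ 2 + 2 * x j ^ 2) := by
    congr 1 with x
    ring
  rw [integral_add ha hs, integral_add (hi.const_mul 2) (hj.const_mul 2), integral_const_mul,
    integral_const_mul, hflip, hswap] at hsum
  linarith

lemma volume_lpNormR_lt_one_ne_zero (hp : 0 < p) :
    volume {x : EuclideanSpace ℝ (Fin d) | lpNormR p x < 1} ≠ 0 :=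
  ((isOpen_lt (continuous_lpNormR hp) continuous_const).measure_pos _
    ⟨0, by simp [lpNormR_zero hp]⟩).ne'

lemma volume_lpNormR_lt_one_ne_top (hp : 0 < p) :
    volume {x : EuclideanSpace ℝ (Fin d) | lpNormR p x < 1} ≠ ∞ :=
  ((measure_mono (setOf_lpNormR_lt_one_subset hp)).trans_lt measure_ball_lt_top).ne

lemma setIntegral_apply_sq_ne_zero (hp : 0 < p) (i : Fin d) :
    ∫ x : EuclideanSpace ℝ (Fin d) in {x | lpNormR p x < 1}, x i ^ 2 ≠ 0 := by
  intro h0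
  have hi : IntegrableOn (fun x : EuclideanSpace ℝ (Fin d) => x i ^ 2) {x | lpNormR p x < 1} := by
    simpa [EuclideanSpace.inner_single_left] using
      integrableOn_inner_sq hp (EuclideanSpace.single i (1 : ℝ))
  have hz := (integral_eq_zero_iff_of_nonneg (fun x => sq_nonneg _) hi).1 h0
  have hne := ae_restrict_of_ae (s := {x : EuclideanSpace ℝ (Fin d) | lpNormR p x < 1})
    (ae_inner_ne_zero (w := EuclideanSpace.single i (1 : ℝ)) (by simp))
  have hfalse : ∀ᵐ _x : EuclideanSpace ℝ (Fin d) ∂volume.restrict {x | lpNormR p x < 1}, False := by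
    filter_upwards [hz, hne] with x hx hx'
    simp [EuclideanSpace.inner_single_left] at hx hx'
    exact hx' hx
  rw [Filter.eventually_false_iff_eq_bot, ae_eq_bot, Measure.restrict_eq_zero] at hfalse
  exact volume_lpNormR_lt_one_ne_zero hp hfalse

end LpNorm

lemma radialMeasure_indicator_univ {n : ℕ} (hn : n ≠ 0) :
    radialMeasure n ((Iio 1).indicator 1) univ ≠ 0 ∧
      radialMeasure n ((Iio 1).indicator 1) univ ≠ ∞ := by
  have h : radialMeasure n ((Iio 1).indicator 1) univ =
      ∫⁻ r in Ioo (0 : ℝ) 1, ENNReal.ofReal (r ^ n * r⁻¹) := by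
    rw [radialMeasure, withDensity_apply _ MeasurableSet.univ, Measure.restrict_univ,
      ← Ioi_inter_Iio, inter_comm, ← Measure.restrict_restrict measurableSet_Iio,
      ← lintegral_indicator measurableSet_Iio]
    refine lintegral_congr fun r => ?_
    by_cases hr : r ∈ Iio (1 : ℝ) <;> simp [hr]
  rw [h]
  constructor
  · refine ne_of_gt ((setLIntegral_pos_iff (by fun_prop)).2 ?_)
    have : Ioo (0 : ℝ) 1 ⊆ Function.support (fun r : ℝ => ENNReal.ofReal (r ^ n * r⁻¹)) := by
      intro r hr
      have : 0 < r ^ n * r⁻¹ := mul_pos (pow_pos hr.1 n) (inv_pos.2 hr.1)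
      simpa using this
    rw [inter_eq_self_of_subset_right this]
    simp
  · refine ne_top_of_le_ne_top (b := ∫⁻ r in Ioo (0 : ℝ) 1, 1) (by simp) ?_
    refine setLIntegral_mono measurable_const fun r hr => ?_
    rw [ENNReal.ofReal_le_one, ← div_eq_mul_inv]
    exact div_le_one_of_le₀ (pow_le_of_le_one hr.1.le hr.2.le hn) hr.1.le

/-- Lemma 4: if X has an l_p-symmetric density with non-increasing ψ, and X₁ and
2^{(1-p)/p}(X₁+X₂) are identically distributed, then p = 2. -/
theorem identically_distributed_implies_p_eq_two
    {d : ℕ} (hd : 2 ≤ d) (p : ℝ) (hp : 0 < p)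
    (ψ : ℝ → ℝ) (hψ : AntitoneOn ψ (Set.Ici 0)) (hψ0 : ∀ t ∈ Set.Ici (0 : ℝ), 0 ≤ ψ t)
    (F : Measure (EuclideanSpace ℝ (Fin d))) [IsProbabilityMeasure F]
    (hF : F = volume.withDensity fun x => ENNReal.ofReal (ψ (lpNormR p x)))
    (hid : F.map (fun y => y ⟨0, by omega⟩) =
      F.map (fun y => (2 : ℝ) ^ ((1 - p) / p) * (y ⟨0, by omega⟩ + y ⟨1, by omega⟩))) :
    p = 2 := by
  set i : Fin d := ⟨0, by omega⟩ with hi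
  set j : Fin d := ⟨1, by omega⟩ with hj
  have hij : i ≠ j := by simp [hi, hj]
  set c : ℝ := (2 : ℝ) ^ ((1 - p) / p) with hc
  have hc0 : 0 < c := by positivity
  set φ : ℝ → ℝ≥0∞ := (Iio 1).indicator 1 with hφ_def
  set ψ' : ℝ → ℝ≥0∞ := fun t => ENNReal.ofReal (ψ (max t 0)) with hψ'_def
  have hφ : Measurable φ := measurable_one.indicator measurableSet_Iio
  have hψ' : Measurable ψ' := by
    have : Antitone fun t => ψ (max t 0) := fun s t hst =>
      hψ (mem_Ici.2 (le_max_right s 0)) (mem_Ici.2 (le_max_right t 0)) (max_le_max_right 0 hst)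
    exact this.measurable.ennreal_ofReal
  have hN : Measurable (lpNormR p : EuclideanSpace ℝ (Fin d) → ℝ) :=
    (continuous_lpNormR hp).measurable
  have hsmul : ∀ r : ℝ, 0 < r → ∀ x : EuclideanSpace ℝ (Fin d),
      lpNormR p (r • x) = r * lpNormR p x := fun r hr x => lpNormR_smul_of_pos hp hr x
  set w₁ : EuclideanSpace ℝ (Fin d) := EuclideanSpace.single i 1 with hw₁_def
  set w₂ : EuclideanSpace ℝ (Fin d) := c • (EuclideanSpace.single i 1 + EuclideanSpace.single j 1)
    with hw₂_def
  have hw₁ : ∀ x, inner ℝ w₁ x = x i := fun x => by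
    simp [hw₁_def, EuclideanSpace.inner_single_left]
  have hw₂ : ∀ x, inner ℝ w₂ x = c * (x i + x j) := fun x => by
    simp [hw₂_def, EuclideanSpace.inner_single_left, inner_add_left, inner_smul_left, mul_add]
  have hw₁0 : w₁ ≠ 0 := by simp [hw₁_def]
  have hw₂0 : w₂ ≠ 0 := by
    intro h
    have := hw₂ w₁
    rw [h, inner_zero_left] at this
    simp [hw₁_def, hij.symm] at this
    exact hc0.ne this
  have hpos : ∀ᵐ x : EuclideanSpace ℝ (Fin d), 0 < lpNormR p x := by
    filter_upwards [ae_inner_ne_zero hw₁0] with x hx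
    rw [hw₁] at hx
    exact (abs_pos.2 hx).trans_le (abs_apply_le_lpNormR hp x i)
  have hF' : F = volume.withDensity fun x => ψ' (lpNormR p x) := by
    rw [hF]
    congr 1 with x
    simp only [hψ'_def, max_eq_left (lpNormR_nonneg x)]
  set G : Measure (EuclideanSpace ℝ (Fin d)) := volume.restrict {x | lpNormR p x < 1} with hG
  have hG' : volume.withDensity (fun x : EuclideanSpace ℝ (Fin d) => φ (lpNormR p x)) = G := by
    rw [hG, ← withDensity_indicator_one (measurableSet_lpNormR_lt_one hp)]
    rfl
  set n := Module.finrank ℝ (EuclideanSpace ℝ (Fin d)) with hn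
  have hn0 : n ≠ 0 := by
    rw [hn, finrank_euclideanSpace_fin]; omega
  -- the radial factor attached to `ψ` is finite and nonzero
  have hmass : radialMeasure n φ univ = G univ * radialMeasure n ψ' univ := by
    have h := congrArg (fun m : Measure (EuclideanSpace ℝ (Fin d)) => m univ)
      (map_smul_gauge_prod_radial_comm hN hsmul hpos hφ hψ')
    rw [← hF', hG', Measure.map_apply (by fun_prop) MeasurableSet.univ,
      Measure.map_apply (by fun_prop) MeasurableSet.univ, preimage_univ, ← univ_prod_univ,
      Measure.prod_prod, Measure.prod_prod, measure_univ, one_mul] at h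
    exact h
  obtain ⟨hrad0, hradtop⟩ := radialMeasure_indicator_univ hn0
  have hG0 : G univ ≠ 0 := by
    simpa [hG] using volume_lpNormR_lt_one_ne_zero (d := d) hp
  have hν0 : radialMeasure n ψ' ≠ 0 := by
    intro h
    exact hrad0 (by rw [← hφ_def, hmass, h]; simp)
  have : IsFiniteMeasure (radialMeasure n ψ') := by
    refine ⟨lt_top_iff_ne_top.2 fun h => hradtop ?_⟩
    rw [← hφ_def, hmass, h, ENNReal.mul_top hG0]
  have hcomm := integral_cpow_mul_integral_cpow_comm hN hsmul hpos hφ hψ'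
  have hmellin : ∀ s : ℂ, ∫ x, ((|inner ℝ w₁ x| : ℝ) : ℂ) ^ s ∂F =
      ∫ x, ((|inner ℝ w₂ x| : ℝ) : ℂ) ^ s ∂F := by
    intro s
    have hmeas : Measurable fun u : ℝ => ((|u| : ℝ) : ℂ) ^ s :=
      (Complex.measurable_ofReal.comp (by fun_prop : Measurable fun u : ℝ => |u|)).pow_const s
    have h := congrArg (fun m : Measure ℝ => ∫ u, ((|u| : ℝ) : ℂ) ^ s ∂m) hid
    rw [integral_map (by fun_prop) hmeas.aestronglyMeasurable,
      integral_map (by fun_prop) hmeas.aestronglyMeasurable] at h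
    simpa only [hw₁, hw₂] using h
  have hpow : ∀ w : EuclideanSpace ℝ (Fin d), w ≠ 0 → ∀ t : ℝ, -1 < t →
      Integrable (fun x => |inner ℝ w x| ^ t) G := fun w hw t ht =>
    (integrableOn_ball_abs_inner_rpow hw ht _).mono_set (setOf_lpNormR_lt_one_subset hp)
  have hsq : ∫ x, inner ℝ w₁ x ^ 2 ∂G = ∫ x, inner ℝ w₂ x ^ 2 ∂G := by
    refine integral_sq_eq_of_eventually_integral_cpow_eq (a := -(1 / 2)) (b := 3)
      (ae_restrict_of_ae (ae_inner_ne_zero hw₁0)) (ae_restrict_of_ae (ae_inner_ne_zero hw₂0))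
      (by norm_num) (by norm_num) (hpow _ hw₁0 _ (by norm_num)) (hpow _ hw₁0 _ (by norm_num))
      (hpow _ hw₂0 _ (by norm_num)) (hpow _ hw₂0 _ (by norm_num)) ?_
    filter_upwards [eventually_integral_cpow_ne_zero hν0 (ae_pos_radialMeasure n ψ')] with t ht
    have h₁ := hcomm (innerSL ℝ w₁) (t * Complex.I)
    have h₂ := hcomm (innerSL ℝ w₂) (t * Complex.I)
    rw [← hF', hG'] at h₁ h₂
    simp only [innerSL_apply_apply] at h₁ h₂
    rw [hmellin, h₂] at h₁
    exact (mul_right_cancel₀ ht h₁).symm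
  simp only [hw₁, hw₂, mul_pow] at hsq
  rw [integral_const_mul, setIntegral_add_sq_eq hp hij] at hsq
  have hc2 : (2 : ℝ) * c ^ 2 = 1 := by
    refine mul_right_cancel₀ (setIntegral_apply_sq_ne_zero hp i) ?_
    linarith
  have hexp : (2 : ℝ) ^ (1 + (1 - p) / p * 2) = 2 ^ (0 : ℝ) := by
    rw [Real.rpow_add two_pos, Real.rpow_mul two_pos.le, Real.rpow_one, Real.rpow_zero, ← hc]
    exact_mod_cast hc2
  have := (Real.rpow_right_inj two_pos (by norm_num)).1 hexp
  field_simp at this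
  linarith
end
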